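/- arXiv:1211.5733 — 2 statements merged into one kernel-verified Lean document; each statement's English description precedes it below -/
import Mathlib

section
/- For all indices 1 ≤ s < t ≤ p and 1 ≤ u < v ≤ p, one has (1/2)·tr(Σ⁻¹ T_{st} Σ⁻¹ T_{uv}) = (λ_s − λ_t)²/(λ_s λ_t) if (s,t) = (u,v) and = 0 otherwise. (These are the Fisher-metric components g_{(s,t)(u,v)} in the eigenvector directions of the spectral coordinate system.) -/
open Matrix

/-- Fisher-metric components in the eigenvector directions:
with `Σ = Γ Λ Γᵗ` and `T_{st} = λ_t γ_t γ_sᵗ − λ_s γ_s γ_tᵗ + λ_t γ_s γ_tᵗ − λ_s γ_t γ_sᵗ`,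
`(1/2)·tr(Σ⁻¹ T_{st} Σ⁻¹ T_{uv}) = (λ_s − λ_t)²/(λ_s λ_t)` if `(s,t) = (u,v)` and `0` otherwise. -/
theorem fisher_metric_eigenvector_directions
    (p : ℕ) (hp : 2 ≤ p)
    (Γ : Matrix (Fin p) (Fin p) ℝ) (hΓ : Γ ∈ Matrix.orthogonalGroup (Fin p) ℝ)
    (lam : Fin p → ℝ) (hlam : StrictAnti lam) (hpos : ∀ i, 0 < lam i)
    (S : Matrix (Fin p) (Fin p) ℝ)
    (hS : S = Γ * Matrix.diagonal lam * Γᵀ)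
    (T : Fin p → Fin p → Matrix (Fin p) (Fin p) ℝ)
    (hT : ∀ s t : Fin p,
      T s t = lam t • Matrix.vecMulVec (fun i => Γ i t) (fun i => Γ i s)
            - lam s • Matrix.vecMulVec (fun i => Γ i s) (fun i => Γ i t)
            + lam t • Matrix.vecMulVec (fun i => Γ i s) (fun i => Γ i t)
            - lam s • Matrix.vecMulVec (fun i => Γ i t) (fun i => Γ i s))
    (s t u v : Fin p) (hst : s < t) (huv : u < v) :
    (1 / 2 : ℝ) * Matrix.trace (S⁻¹ * T s t * S⁻¹ * T u v) =
      if s = u ∧ t = v then (lam s - lam t) ^ 2 / (lam s * lam t) else 0 := by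
  have hG : Γᵀ * Γ = 1 := by
    have := (Matrix.mem_orthogonalGroup_iff' (Fin p) ℝ).1 hΓ
    simpa [Matrix.star_eq_conjTranspose] using this
  have hG' : Γ * Γᵀ = 1 := mul_eq_one_comm.1 hG
  have hdot : ∀ a b : Fin p, (fun i => Γ i a) ⬝ᵥ (fun i => Γ i b) = if a = b then 1 else 0 := by
    intro a b
    have := congrFun (congrFun hG a) b
    simpa [Matrix.mul_apply, Matrix.one_apply, dotProduct] using this
  have hinv : S⁻¹ = Γ * Matrix.diagonal (fun i => (lam i)⁻¹) * Γᵀ := by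
    apply Matrix.inv_eq_right_inv
    rw [hS]
    calc Γ * Matrix.diagonal lam * Γᵀ * (Γ * Matrix.diagonal (fun i => (lam i)⁻¹) * Γᵀ)
        = Γ * Matrix.diagonal lam * (Γᵀ * Γ) * Matrix.diagonal (fun i => (lam i)⁻¹) * Γᵀ := by
          simp only [Matrix.mul_assoc]
      _ = Γ * (Matrix.diagonal lam * Matrix.diagonal (fun i => (lam i)⁻¹)) * Γᵀ := by
          rw [hG, Matrix.mul_one, Matrix.mul_assoc Γ]
      _ = 1 := by
          rw [Matrix.diagonal_mul_diagonal]
          simp [fun i => mul_inv_cancel₀ (hpos i).ne', hG']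
  have hvec : ∀ a : Fin p, S⁻¹ *ᵥ (fun i => Γ i a) = (lam a)⁻¹ • (fun i => Γ i a) := by
    intro a
    have h1 : S⁻¹ * Γ = Γ * Matrix.diagonal (fun i => (lam i)⁻¹) := by
      rw [hinv, Matrix.mul_assoc, hG, Matrix.mul_one]
    ext i
    have := congrFun (congrFun h1 i) a
    rw [Matrix.mul_diagonal, mul_comm] at this
    simpa [Matrix.mul_apply, Matrix.mulVec, dotProduct] using this
  have hST : ∀ a b : Fin p, S⁻¹ * T a b = (lam b - lam a) •
      ((lam b)⁻¹ • Matrix.vecMulVec (fun i => Γ i b) (fun i => Γ i a)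
        + (lam a)⁻¹ • Matrix.vecMulVec (fun i => Γ i a) (fun i => Γ i b)) := by
    intro a b
    rw [hT]
    simp only [Matrix.mul_sub, Matrix.mul_add, Matrix.mul_smul, Matrix.mul_vecMulVec, hvec,
      Matrix.smul_vecMulVec]
    module
  have htr : ∀ a b c d : Fin p,
      Matrix.trace (Matrix.vecMulVec (fun i => Γ i a) (fun i => Γ i b)
        * Matrix.vecMulVec (fun i => Γ i c) (fun i => Γ i d))
      = (if b = c then 1 else 0) * (if a = d then 1 else 0) := by
    intro a b c d
    rw [Matrix.vecMulVec_mul_vecMulVec, Matrix.trace_vecMulVec, dotProduct_smul, hdot, hdot,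
      smul_eq_mul]
  rw [Matrix.mul_assoc (S⁻¹ * T s t), hST, hST]
  simp only [Matrix.smul_mul, Matrix.mul_smul, Matrix.add_mul, Matrix.mul_add, Matrix.trace_add,
    Matrix.trace_smul, htr, smul_eq_mul]
  have hs := (hpos s).ne'
  have ht := (hpos t).ne'
  by_cases h : s = u ∧ t = v
  · obtain ⟨rfl, rfl⟩ := h
    simp only [hst.ne, hst.ne', if_true, if_false, and_self]
    field_simp
    ring
  · rw [if_neg h]
    have e1 : ¬ (s = v ∧ t = u) := by
      rintro ⟨rfl, rfl⟩
      exact absurd hst huv.asymm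
    have e1' : (if s = v then (1:ℝ) else 0) * (if t = u then 1 else 0) = 0 := by
      split_ifs <;> simp_all
    have e2' : (if s = u then (1:ℝ) else 0) * (if t = v then 1 else 0) = 0 := by
      split_ifs <;> simp_all
    rw [mul_comm (if t = v then (1:ℝ) else 0), mul_comm (if t = u then (1:ℝ) else 0), e1', e2']
    simp
end

section
/- Fix l̄_1 > ⋯ > l̄_p > 0 and L̄ = diag(l̄_1,…,l̄_p). For each real n > 0 and each 1 ≤ i ≤ p define λ̂*_i(n) = [∫_{O(p)} (Γᵗ L̄ Γ)_{ii} · exp(−(n/2)·tr(L̄ Γᵗ L̄⁻¹ Γ)) dμ(Γ)] / [∫_{O(p)} exp(−(n/2)·tr(L̄ Γᵗ L̄⁻¹ Γ)) dμ(Γ)]. Then for every i, λ̂*_i(n) → l̄_i as n → ∞. (That is, the proposed estimator λ̂* converges to the naive sample-eigenvalue estimator l̄ as the sample size grows; the exponential weight concentrates, as n → ∞, on the minimizers of Γ ↦ tr(L̄ Γᵗ L̄⁻¹ Γ), which are the diagonal sign matrices, at which (Γᵗ L̄ Γ)_{ii} = l̄_i.) -/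
open Matrix MeasureTheory Filter

/-- The product σ-algebra on real matrices (the Borel σ-algebra of entrywise convergence). -/
instance matrixMeasurableSpace {m n : Type*} : MeasurableSpace (Matrix m n ℝ) :=
  MeasurableSpace.pi

theorem laplace_aux {α : Type*} [MeasurableSpace α] (μ : Measure α) [IsProbabilityMeasure μ]
    (T h : α → ℝ) (hT : Measurable T) (hh : Measurable h) (t0 h0 M K : ℝ) (hK : 0 ≤ K)
    (hTl : ∀ᵐ x ∂μ, t0 ≤ T x) (hTu : ∀ᵐ x ∂μ, T x ≤ M)
    (hb : ∀ᵐ x ∂μ, |h x - h0| ≤ K * (T x - t0))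
    (hpos : ∀ δ > 0, μ {x | T x < t0 + δ} ≠ 0) :
    Tendsto (fun n : ℝ => (∫ x, h x * Real.exp (-(n / 2) * T x) ∂μ) /
      (∫ x, Real.exp (-(n / 2) * T x) ∂μ)) atTop (nhds h0) := by
  have hM : t0 ≤ M := by
    obtain ⟨x, h1, h2⟩ := (hTl.and hTu).exists
    exact h1.trans h2
  have key : ∀ ε > 0, ∀ n ≥ (0:ℝ), |(∫ x, h x * Real.exp (-(n / 2) * T x) ∂μ) /
      (∫ x, Real.exp (-(n / 2) * T x) ∂μ) - h0| ≤
      K * ε + K * (M - t0) / μ.real {x | T x < t0 + ε / 2} * Real.exp (-(n * (ε / 4))) := by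
    intro ε hε n hn
    set m := μ.real {x | T x < t0 + ε / 2} with hm
    have hmpos : 0 < m := by
      rw [hm, measureReal_def]
      exact ENNReal.toReal_pos (hpos _ (by positivity)) (measure_ne_top _ _)
    set E : α → ℝ := fun x => Real.exp (-(n / 2) * T x) with hE
    have hEm : Measurable E := by fun_prop
    have hEb : ∀ᵐ x ∂μ, ‖E x‖ ≤ Real.exp (-(n / 2) * t0) := by
      filter_upwards [hTl] with x hx
      rw [Real.norm_of_nonneg (Real.exp_pos _).le]
      apply Real.exp_le_exp.2
      nlinarith
    have hEi : Integrable E μ := Integrable.of_bound hEm.aestronglyMeasurable _ hEb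
    have hhi : Integrable (fun x => (h x - h0) * E x) μ := by
      refine Integrable.bdd_mul (c := K * (M - t0)) hEi
        (hh.sub_const _).aestronglyMeasurable ?_
      filter_upwards [hb, hTu] with x h1 h2
      rw [Real.norm_eq_abs]
      refine h1.trans ?_
      gcongr
    have hZ : Real.exp (-(n / 2) * (t0 + ε / 2)) * m ≤ ∫ x, E x ∂μ := by
      have hs : MeasurableSet {x | T x < t0 + ε / 2} := measurableSet_lt hT measurable_const
      calc Real.exp (-(n / 2) * (t0 + ε / 2)) * m
          = ∫ x, Set.indicator {x | T x < t0 + ε / 2}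
              (fun _ => Real.exp (-(n / 2) * (t0 + ε / 2))) x ∂μ := by
            rw [integral_indicator_const _ hs, smul_eq_mul, mul_comm]
        _ ≤ _ := by
            refine integral_mono ((integrable_const _).indicator hs) hEi ?_
            intro x
            by_cases hx : x ∈ {x | T x < t0 + ε / 2}
            · rw [Set.indicator_of_mem hx]
              apply Real.exp_le_exp.2
              have : T x < t0 + ε / 2 := hx
              nlinarith
            · rw [Set.indicator_of_notMem hx]
              exact (Real.exp_pos _).le
    have hZpos : 0 < ∫ x, E x ∂μ := lt_of_lt_of_le (by positivity) hZ
    have e1 : (∫ x, h x * E x ∂μ) = (∫ x, (h x - h0) * E x ∂μ) + h0 * ∫ x, E x ∂μ := by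
      rw [← integral_const_mul, ← integral_add hhi (hEi.const_mul _)]
      congr 1; ext x; ring
    have e2 : |∫ x, (h x - h0) * E x ∂μ| ≤
        K * ε * (∫ x, E x ∂μ) + K * (M - t0) * Real.exp (-(n / 2) * (t0 + ε)) := by
      calc |∫ x, (h x - h0) * E x ∂μ| ≤ ∫ x, |(h x - h0) * E x| ∂μ := abs_integral_le_integral_abs
        _ ≤ ∫ x, (K * ε * E x + K * (M - t0) * Real.exp (-(n / 2) * (t0 + ε))) ∂μ := by
          refine integral_mono_ae hhi.abs ((hEi.const_mul _).add (integrable_const _)) ?_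
          filter_upwards [hb, hTu, hTl] with x h1 h2 h3
          have hp := Real.exp_pos (-(n / 2) * T x)
          have hp2 := Real.exp_pos (-(n / 2) * (t0 + ε))
          rw [abs_mul, abs_of_pos hp]
          have hM' : 0 ≤ M - t0 := by linarith
          by_cases hx : T x ≤ t0 + ε
          · have : |h x - h0| ≤ K * ε := h1.trans (by gcongr; linarith)
            have := mul_le_mul_of_nonneg_right this hp.le
            have : 0 ≤ K * (M - t0) * Real.exp (-(n / 2) * (t0 + ε)) := by positivity
            simp only [hE]
            linarith
          · have a1 : |h x - h0| ≤ K * (M - t0) := h1.trans (by gcongr)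
            have a2 : Real.exp (-(n / 2) * T x) ≤ Real.exp (-(n / 2) * (t0 + ε)) := by
              apply Real.exp_le_exp.2
              nlinarith
            have := mul_le_mul a1 a2 hp.le (by positivity)
            have : 0 ≤ K * ε * Real.exp (-(n / 2) * T x) := by positivity
            simp only [hE]
            linarith
        _ = _ := by
          rw [integral_add (hEi.const_mul _) (integrable_const _), integral_const_mul]
          simp
    have e3 : (∫ x, h x * E x ∂μ) / (∫ x, E x ∂μ) - h0
        = (∫ x, (h x - h0) * E x ∂μ) / (∫ x, E x ∂μ) := by
      rw [e1]; field_simp; ring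
    rw [e3, abs_div, abs_of_pos hZpos, div_le_iff₀ hZpos]
    refine e2.trans ?_
    have e4 : Real.exp (-(n / 2) * (t0 + ε)) =
        Real.exp (-(n * (ε / 4))) * Real.exp (-(n / 2) * (t0 + ε / 2)) := by
      rw [← Real.exp_add]; congr 1; ring
    have e5 : K * (M - t0) * Real.exp (-(n / 2) * (t0 + ε)) =
        K * (M - t0) / m * Real.exp (-(n * (ε / 4))) *
          (Real.exp (-(n / 2) * (t0 + ε / 2)) * m) := by
      rw [e4]; field_simp
    rw [e5, add_mul]
    have hM' : 0 ≤ M - t0 := by linarith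
    gcongr
  rw [Metric.tendsto_nhds]
  intro η hη
  have hε : 0 < η / (2 * (K + 1)) := by positivity
  set ε := η / (2 * (K + 1)) with hεd
  have hKε : K * ε < η := by
    rw [hεd, mul_div_assoc', div_lt_iff₀ (by positivity)]
    nlinarith
  have hlim : Tendsto (fun n : ℝ => K * ε + K * (M - t0) / μ.real {x | T x < t0 + ε / 2} *
      Real.exp (-(n * (ε / 4)))) atTop (nhds (K * ε + K * (M - t0) /
        μ.real {x | T x < t0 + ε / 2} * 0)) := by
    refine tendsto_const_nhds.add (tendsto_const_nhds.mul ?_)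
    exact Real.tendsto_exp_neg_atTop_nhds_zero.comp
      (tendsto_id.atTop_mul_const (by positivity))
  rw [mul_zero, add_zero] at hlim
  filter_upwards [hlim.eventually_lt_const hKε, eventually_ge_atTop 0] with n h1 h2
  rw [Real.dist_eq]
  exact (key ε hε n h2).trans_lt h1

theorem trace_formula {p : ℕ} (l : Fin p → ℝ) (hl : ∀ i, 0 < l i)
    (Γ : Matrix (Fin p) (Fin p) ℝ) :
    Matrix.trace (diagonal l * Γᵀ * (diagonal l)⁻¹ * Γ) = ∑ i, ∑ j, Γ j i ^ 2 * (l i / l j) := by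
  have hinv : (diagonal l)⁻¹ = diagonal (fun i => (l i)⁻¹) := by
    apply Matrix.inv_eq_right_inv
    rw [diagonal_mul_diagonal, ← diagonal_one]
    congr 1; ext i
    exact mul_inv_cancel₀ (hl i).ne'
  rw [hinv, Matrix.trace]
  refine Finset.sum_congr rfl fun i _ => ?_
  rw [diag_apply, Matrix.mul_apply]
  refine Finset.sum_congr rfl fun j _ => ?_
  rw [mul_diagonal, diagonal_mul, transpose_apply]
  ring

theorem entry_formula {p : ℕ} (l : Fin p → ℝ) (Γ : Matrix (Fin p) (Fin p) ℝ) (i : Fin p) :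
    (Γᵀ * diagonal l * Γ) i i = ∑ j, Γ j i ^ 2 * l j := by
  rw [Matrix.mul_apply]
  refine Finset.sum_congr rfl fun j _ => ?_
  rw [mul_diagonal, transpose_apply]
  ring

theorem col_sum {p : ℕ} {Γ : Matrix (Fin p) (Fin p) ℝ}
    (h : Γ ∈ Matrix.orthogonalGroup (Fin p) ℝ) (i : Fin p) : ∑ j, Γ j i ^ 2 = 1 := by
  have := congrFun (congrFun ((Matrix.mem_orthogonalGroup_iff' (Fin p) ℝ).1 h) i) i
  rw [Matrix.mul_apply, one_apply_eq] at this
  rw [← this]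
  refine Finset.sum_congr rfl fun j _ => ?_
  simp [star_apply, sq]

theorem row_sum {p : ℕ} {Γ : Matrix (Fin p) (Fin p) ℝ}
    (h : Γ ∈ Matrix.orthogonalGroup (Fin p) ℝ) (j : Fin p) : ∑ i, Γ j i ^ 2 = 1 := by
  have := congrFun (congrFun ((Matrix.mem_orthogonalGroup_iff (Fin p) ℝ).1 h) j) j
  rw [Matrix.mul_apply, one_apply_eq] at this
  rw [← this]
  refine Finset.sum_congr rfl fun j _ => ?_
  simp [star_apply, sq]

/-- The nonnegative gap weight. -/
noncomputable def gapw (x : ℝ) : ℝ := x - 1 - Real.log x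

theorem gapw_nonneg {x : ℝ} (hx : 0 < x) : 0 ≤ gapw x := by
  have := Real.log_le_sub_one_of_pos hx
  unfold gapw; linarith

theorem gapw_pos {x : ℝ} (hx : 0 < x) (h1 : x ≠ 1) : 0 < gapw x := by
  have := Real.log_lt_sub_one_of_pos hx h1
  unfold gapw; linarith

theorem gap_formula {p : ℕ} (l : Fin p → ℝ) (hl : ∀ i, 0 < l i)
    {Γ : Matrix (Fin p) (Fin p) ℝ} (h : Γ ∈ Matrix.orthogonalGroup (Fin p) ℝ) :
    ∑ i, ∑ j, Γ j i ^ 2 * (l i / l j) - p = ∑ i, ∑ j, Γ j i ^ 2 * gapw (l i / l j) := by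
  have h1 : ∑ i, ∑ j, Γ j i ^ 2 = (p : ℝ) := by simp [col_sum h]
  have h2 : ∑ i, ∑ j, Γ j i ^ 2 * Real.log (l i) = ∑ i, Real.log (l i) := by
    refine Finset.sum_congr rfl fun i _ => ?_
    rw [← Finset.sum_mul, col_sum h, one_mul]
  have h3 : ∑ i, ∑ j, Γ j i ^ 2 * Real.log (l j) = ∑ i, Real.log (l i) := by
    rw [Finset.sum_comm]
    refine Finset.sum_congr rfl fun i _ => ?_
    rw [← Finset.sum_mul, row_sum h, one_mul]
  have h4 : ∑ i, ∑ j, Γ j i ^ 2 * gapw (l i / l j) =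
      ∑ i, ∑ j, Γ j i ^ 2 * (l i / l j) - ∑ i, ∑ j, Γ j i ^ 2
      - (∑ i, ∑ j, Γ j i ^ 2 * Real.log (l i) - ∑ i, ∑ j, Γ j i ^ 2 * Real.log (l j)) := by
    simp only [← Finset.sum_sub_distrib]
    refine Finset.sum_congr rfl fun i _ => Finset.sum_congr rfl fun j _ => ?_
    rw [gapw, Real.log_div (hl i).ne' (hl j).ne']
    ring
  rw [h4, h1, h2, h3]; ring

theorem entry_bound {p : ℕ} (l : Fin p → ℝ) (hl : ∀ i, 0 < l i) (hinj : Function.Injective l)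
    (i : Fin p) : ∃ K, 0 ≤ K ∧ ∀ Γ ∈ Matrix.orthogonalGroup (Fin p) ℝ,
      |∑ j, Γ j i ^ 2 * l j - l i| ≤ K * (∑ i, ∑ j, Γ j i ^ 2 * (l i / l j) - p) := by
  have hg : ∀ a b, 0 ≤ gapw (l a / l b) := fun a b => gapw_nonneg (div_pos (hl a) (hl b))
  have hq : ∀ j, 0 ≤ |l j - l i| / gapw (l i / l j) := fun j => div_nonneg (abs_nonneg _) (hg _ _)
  refine ⟨∑ j, |l j - l i| / gapw (l i / l j), Finset.sum_nonneg fun j _ => hq j, ?_⟩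
  intro Γ hΓ
  rw [gap_formula l hl hΓ]
  set K := ∑ j, |l j - l i| / gapw (l i / l j) with hK
  have hKn : 0 ≤ K := Finset.sum_nonneg fun j _ => hq j
  have hc : ∀ j, |l j - l i| ≤ K * gapw (l i / l j) := by
    intro j
    by_cases hj : j = i
    · subst hj
      rw [sub_self, abs_zero]
      exact mul_nonneg hKn (hg _ _)
    · have hne : l i / l j ≠ 1 := by
        intro h
        rw [div_eq_one_iff_eq (hl j).ne'] at h
        exact hj (hinj h.symm)
      have hp := gapw_pos (div_pos (hl i) (hl j)) hne
      rw [← div_le_iff₀ hp]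
      exact Finset.single_le_sum (f := fun j => |l j - l i| / gapw (l i / l j))
        (fun j _ => hq j) (Finset.mem_univ j)
  have e : ∑ j, Γ j i ^ 2 * l j - l i = ∑ j, Γ j i ^ 2 * (l j - l i) := by
    simp only [mul_sub, Finset.sum_sub_distrib, ← Finset.sum_mul, col_sum hΓ, one_mul]
  rw [e]
  calc |∑ j, Γ j i ^ 2 * (l j - l i)| ≤ ∑ j, |Γ j i ^ 2 * (l j - l i)| :=
        Finset.abs_sum_le_sum_abs _ _
    _ ≤ ∑ j, K * (Γ j i ^ 2 * gapw (l i / l j)) := by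
        refine Finset.sum_le_sum fun j _ => ?_
        rw [abs_mul, abs_of_nonneg (sq_nonneg _)]
        have := mul_le_mul_of_nonneg_left (hc j) (sq_nonneg (Γ j i))
        linarith
    _ = K * ∑ j, Γ j i ^ 2 * gapw (l i / l j) := by rw [Finset.mul_sum]
    _ ≤ _ := by
        refine mul_le_mul_of_nonneg_left ?_ hKn
        exact Finset.single_le_sum (f := fun i => ∑ j, Γ j i ^ 2 * gapw (l i / l j))
          (fun a _ => Finset.sum_nonneg fun b _ => mul_nonneg (sq_nonneg _) (hg _ _))
          (Finset.mem_univ i)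

theorem measurable_entry {p : ℕ} (i j : Fin p) :
    Measurable (fun Γ : Matrix (Fin p) (Fin p) ℝ => Γ i j) :=
  (measurable_pi_apply j).comp (measurable_pi_apply i)

theorem nbhd_pos {p : ℕ} (μ : Measure (Matrix (Fin p) (Fin p) ℝ)) [IsProbabilityMeasure μ]
    (hcarrier : ∀ᵐ Γ ∂μ, Γ ∈ Matrix.orthogonalGroup (Fin p) ℝ)
    (hinv : ∀ Q ∈ Matrix.orthogonalGroup (Fin p) ℝ,
      Measure.map (fun Γ => Q * Γ) μ = μ)
    (T : Matrix (Fin p) (Fin p) ℝ → ℝ) (hT : Continuous T) (hTm : Measurable T)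
    (c : ℝ) (h1 : T 1 < c) : μ {Γ | T Γ < c} ≠ 0 := by
  intro h0
  haveI : SecondCountableTopology (Matrix (Fin p) (Fin p) ℝ) :=
    inferInstanceAs (SecondCountableTopology (Fin p → Fin p → ℝ))
  have hz : μ {Γ | Γ ∈ Matrix.orthogonalGroup (Fin p) ℝ} = 0 := by
    refine measure_null_of_locally_null _ fun Q hQ => ?_
    have hQ' : star Q ∈ Matrix.orthogonalGroup (Fin p) ℝ := Unitary.star_mem hQ
    refine ⟨(fun Γ => star Q * Γ) ⁻¹' {Γ | T Γ < c}, ?_, ?_⟩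
    · apply mem_nhdsWithin_of_mem_nhds
      apply IsOpen.mem_nhds
      · exact (isOpen_lt hT continuous_const).preimage (by fun_prop)
      · have : star Q * Q = 1 := (Matrix.mem_orthogonalGroup_iff' (Fin p) ℝ).1 hQ
        simp only [Set.mem_preimage, Set.mem_setOf_eq, this, h1]
    · have hm : Measurable (fun Γ : Matrix (Fin p) (Fin p) ℝ => star Q * Γ) := by
        refine measurable_pi_lambda _ fun a => measurable_pi_lambda _ fun b => ?_
        simp only [Matrix.mul_apply]
        exact Finset.measurable_sum _ fun k _ => (measurable_entry k b).const_mul _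
      rw [← Measure.map_apply hm (measurableSet_lt hTm measurable_const), hinv _ hQ', h0]
  have hz2 : μ {Γ | Γ ∈ Matrix.orthogonalGroup (Fin p) ℝ}ᶜ = 0 := hcarrier
  have := measure_union_null hz hz2
  rw [Set.union_compl_self, measure_univ] at this
  exact one_ne_zero this

/-- As the sample size `n → ∞`, the estimator `λ̂*(n)` converges to the
naive sample-eigenvalue estimator `l̄`: for each `i`,
`λ̂*_i(n) = [∫ (Γᵗ L̄ Γ)_{ii} e^{−(n/2) tr(L̄ Γᵗ L̄⁻¹ Γ)} dμ]/[∫ e^{−(n/2) tr(L̄ Γᵗ L̄⁻¹ Γ)} dμ]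
→ l̄_i`. Here `μ` is formalized as a probability measure on matrix space carried by `O(p)`
and invariant under left multiplication by orthogonal matrices (these properties
characterize the Haar probability measure of `O(p)`). -/
theorem shrinkage_estimator_limit
    (p : ℕ) (hp : 1 ≤ p)
    (μ : Measure (Matrix (Fin p) (Fin p) ℝ)) [IsProbabilityMeasure μ]
    (hcarrier : ∀ᵐ Γ ∂μ, Γ ∈ Matrix.orthogonalGroup (Fin p) ℝ)
    (hinv : ∀ Q ∈ Matrix.orthogonalGroup (Fin p) ℝ,
      Measure.map (fun Γ => Q * Γ) μ = μ)
    (lbar : Fin p → ℝ) (hl : StrictAnti lbar) (hlpos : ∀ i, 0 < lbar i)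
    (Lbar : Matrix (Fin p) (Fin p) ℝ) (hLbar : Lbar = Matrix.diagonal lbar)
    (lamstar : ℝ → Fin p → ℝ)
    (hlamstar : ∀ (n : ℝ) (i : Fin p), lamstar n i =
      (∫ Γ, (Γᵀ * Lbar * Γ) i i *
          Real.exp (-(n / 2) * Matrix.trace (Lbar * Γᵀ * Lbar⁻¹ * Γ)) ∂μ) /
        (∫ Γ, Real.exp (-(n / 2) * Matrix.trace (Lbar * Γᵀ * Lbar⁻¹ * Γ)) ∂μ))
    (i : Fin p) :
    Tendsto (fun n : ℝ => lamstar n i) atTop (nhds (lbar i)) := by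
  subst hLbar
  have hfun : (fun n : ℝ => lamstar n i) = fun n : ℝ =>
      (∫ Γ, (∑ j, Γ j i ^ 2 * lbar j) *
        Real.exp (-(n / 2) * (∑ i, ∑ j, Γ j i ^ 2 * (lbar i / lbar j))) ∂μ) /
      (∫ Γ, Real.exp (-(n / 2) * (∑ i, ∑ j, Γ j i ^ 2 * (lbar i / lbar j))) ∂μ) := by
    ext n
    rw [hlamstar]
    simp only [trace_formula lbar hlpos, entry_formula]
  rw [hfun]
  obtain ⟨K, hK, hb⟩ := entry_bound lbar hlpos hl.injective i
  have hTm : Measurable (fun Γ : Matrix (Fin p) (Fin p) ℝ =>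
      ∑ i, ∑ j, Γ j i ^ 2 * (lbar i / lbar j)) :=
    Finset.measurable_sum _ fun a _ => Finset.measurable_sum _ fun b _ =>
      ((measurable_entry b a).pow_const 2).mul_const _
  refine laplace_aux μ (fun Γ => ∑ i, ∑ j, Γ j i ^ 2 * (lbar i / lbar j))
    (fun Γ => ∑ j, Γ j i ^ 2 * lbar j) hTm ?_ (p : ℝ) (lbar i)
    (∑ i, ∑ j, lbar i / lbar j) K hK ?_ ?_ ?_ ?_
  · exact Finset.measurable_sum _ fun b _ =>
      ((measurable_entry b i).pow_const 2).mul_const _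
  · filter_upwards [hcarrier] with Γ hΓ
    rw [← sub_nonneg, gap_formula lbar hlpos hΓ]
    exact Finset.sum_nonneg fun a _ => Finset.sum_nonneg fun b _ =>
      mul_nonneg (sq_nonneg _) (gapw_nonneg (div_pos (hlpos a) (hlpos b)))
  · filter_upwards [hcarrier] with Γ hΓ
    refine Finset.sum_le_sum fun a _ => Finset.sum_le_sum fun b _ => ?_
    refine mul_le_of_le_one_left (div_pos (hlpos a) (hlpos b)).le ?_
    rw [← col_sum hΓ a]
    exact Finset.single_le_sum (f := fun j => Γ j a ^ 2) (fun j _ => sq_nonneg _)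
      (Finset.mem_univ b)
  · filter_upwards [hcarrier] with Γ hΓ
    exact hb Γ hΓ
  · intro δ hδ
    refine nbhd_pos μ hcarrier hinv _ ?_ hTm _ ?_
    · refine continuous_finsetSum _ fun a _ => continuous_finsetSum _ fun b _ => ?_
      exact ((continuous_id.matrix_elem b a).pow 2).mul continuous_const
    · have h1 := gap_formula lbar hlpos (one_mem (Matrix.orthogonalGroup (Fin p) ℝ))
      have h2 : ∑ i, ∑ j, (1 : Matrix (Fin p) (Fin p) ℝ) j i ^ 2 * gapw (lbar i / lbar j) = 0 := by
        refine Finset.sum_eq_zero fun a _ => Finset.sum_eq_zero fun b _ => ?_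
        by_cases hab : b = a
        · subst hab
          simp [gapw, div_self (hlpos b).ne']
        · simp [Matrix.one_apply_ne hab]
      linarith
end
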